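/- arXiv:2401.02006 — 2 statements merged into one kernel-verified Lean document; each statement's English description precedes it below -/
import Mathlib

section
/- Let R → A be a ring homomorphism with R commutative noetherian, and let M be an A-module. Assume: (F1) Tor_1^A(A/lA, M) = 0 for every (possibly non-prime) ideal l of R; (F2) the (A ⊗_R k(p))-module M ⊗_R k(p) is flat for every prime ideal p of R; and moreover either (F3a) A is a noetherian ring, or (F3b) Tor_1^A((A/pA)_tf, M) = 0 for every prime ideal p of R. Then M is a flat A-module. -/
/-!
Theorem 4.2: let `R` be noetherian, `R → A` a ring map and `M` an `A`-module.  Assume: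
(F1) `Tor₁^A(A/lA, M) = 0` for every ideal `l` of `R`;
(F2) the fiber `M ⊗_R k(p)` is a flat `A ⊗_R k(p)`-module for every prime `p` of `R`
(realized as the base change `(A ⊗[R] k(p)) ⊗[A] M`, with `k(p) = Frac(R ⧸ p)`);
and either (F3a) `A` is noetherian, or (F3b) `Tor₁^A((A/pA)_tf, M) = 0` for every prime `p`,
where `(A/pA)_tf` is the quotient of `A/pA` by its `R/p`-torsion submodule.
Then `M` is flat over `A`.
-/

set_option synthInstance.maxHeartbeats 1000000

open TensorProduct CategoryTheory

/-- The torsion of `N` with respect to the domain `R ⧸ p` (acting through `f : R →+* B`),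
as a `B`-submodule of `N`: the elements killed by (the image of) some `r ∉ p`, i.e. by some
nonzero element of `R ⧸ p`. -/
def relTorsion (R : Type) [CommRing R] (p : Ideal R) (hp : p.IsPrime)
    (B : Type) [CommRing B] (f : R →+* B)
    (N : Type) [AddCommGroup N] [Module B N] : Submodule B N where
  carrier := {x | ∃ r : R, r ∉ p ∧ f r • x = 0}
  zero_mem' := ⟨1, fun h => hp.ne_top ((Ideal.eq_top_iff_one p).mpr h), smul_zero _⟩
  add_mem' := by
    rintro x y ⟨r, hr, hrx⟩ ⟨s, hs, hsy⟩
    refine ⟨r * s, fun h => (hp.mem_or_mem h).elim hr hs, ?_⟩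
    have h1 : (f r * f s) • x = 0 := by rw [mul_comm, mul_smul, hrx, smul_zero]
    have h2 : (f r * f s) • y = 0 := by rw [mul_smul, hsy, smul_zero]
    rw [map_mul, smul_add, h1, h2, add_zero]
  smul_mem' := by
    rintro b x ⟨r, hr, hrx⟩
    refine ⟨r, hr, ?_⟩
    rw [smul_smul, mul_comm, ← smul_smul, hrx, smul_zero]

section Presentation

variable {A K F M : Type} [CommRing A] [AddCommGroup K] [Module A K] [AddCommGroup F] [Module A F]
  [AddCommGroup M] [Module A M]

theorem lTensor_rTensor_apply {N N' X Y : Type} [AddCommGroup N] [Module A N] [AddCommGroup N']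
    [Module A N'] [AddCommGroup X] [Module A X] [AddCommGroup Y] [Module A Y]
    (f : N →ₗ[A] N') (h : X →ₗ[A] Y) (x : N ⊗[A] X) :
    h.lTensor N' (f.rTensor X x) = f.rTensor Y (h.lTensor N x) := by
  rw [← LinearMap.comp_apply, ← LinearMap.comp_apply, LinearMap.lTensor_comp_rTensor,
    LinearMap.rTensor_comp_lTensor]

variable {N₁ N₂ N₃ : Type} [AddCommGroup N₁] [Module A N₁] [AddCommGroup N₂] [Module A N₂]
  [AddCommGroup N₃] [Module A N₃] {f : N₁ →ₗ[A] N₂} {g : N₂ →ₗ[A] N₃}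
  (hf : Function.Injective f) (hfg : Function.Exact f g) (hg : Function.Surjective g)

include hf hfg hg in
theorem lTensor_injective_of_extension [Module.Flat A F] {j : K →ₗ[A] F}
    (h₁ : Function.Injective (j.lTensor N₁)) (h₃ : Function.Injective (j.lTensor N₃)) :
    Function.Injective (j.lTensor N₂) := by
  rw [injective_iff_map_eq_zero]
  intro x hx
  have h0 : g.rTensor K x = 0 := by
    apply (injective_iff_map_eq_zero _).1 h₃
    rw [lTensor_rTensor_apply, hx, map_zero]
  obtain ⟨y, rfl⟩ := (rTensor_exact K hfg hg x).1 h0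
  rw [lTensor_rTensor_apply] at hx
  have := (injective_iff_map_eq_zero _).1
    (Module.Flat.rTensor_preserves_injective_linearMap (M := F) f hf) _ hx
  rw [(injective_iff_map_eq_zero _).1 h₁ _ this, map_zero]

include hf hfg hg in
theorem rTensor_injective_of_lTensor_injective [Module.Flat A F] {j : K →ₗ[A] F} {q : F →ₗ[A] M}
    (hjq : Function.Exact j q) (hq : Function.Surjective q)
    (h₃ : Function.Injective (j.lTensor N₃)) :
    Function.Injective (f.rTensor M) := by
  rw [injective_iff_map_eq_zero]
  intro z hz
  obtain ⟨w, rfl⟩ := LinearMap.lTensor_surjective N₁ hq z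
  rw [← lTensor_rTensor_apply] at hz
  obtain ⟨u, hu⟩ := (lTensor_exact N₂ hjq hq _).1 hz
  have h0 : g.rTensor K u = 0 := by
    apply (injective_iff_map_eq_zero _).1 h₃
    rw [lTensor_rTensor_apply, hu]
    exact (rTensor_exact F hfg hg).apply_apply_eq_zero w
  obtain ⟨v, rfl⟩ := (rTensor_exact K hfg hg u).1 h0
  rw [lTensor_rTensor_apply] at hu
  rw [← Module.Flat.rTensor_preserves_injective_linearMap (M := F) f hf hu]
  exact (lTensor_exact N₁ hjq hq).apply_apply_eq_zero v

include hfg hg in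
theorem lTensor_injective_of_rTensor_injective [Module.Flat A F] {j : K →ₗ[A] F} {q : F →ₗ[A] M}
    (hjq : Function.Exact j q) (hq : Function.Surjective q)
    (h₂ : Function.Injective (j.lTensor N₂)) (h : Function.Injective (f.rTensor M)) :
    Function.Injective (j.lTensor N₃) := by
  rw [injective_iff_map_eq_zero]
  intro x hx
  obtain ⟨y, rfl⟩ := LinearMap.rTensor_surjective K hg x
  rw [lTensor_rTensor_apply] at hx
  obtain ⟨w, hw⟩ := (rTensor_exact F hfg hg _).1 hx
  have h0 : q.lTensor N₁ w = 0 := by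
    apply (injective_iff_map_eq_zero _).1 h
    rw [← lTensor_rTensor_apply, hw]
    exact (lTensor_exact N₂ hjq hq).apply_apply_eq_zero y
  obtain ⟨v, rfl⟩ := (lTensor_exact N₁ hjq hq w).1 h0
  rw [← lTensor_rTensor_apply] at hw
  rw [← h₂ hw]
  exact (rTensor_exact K hfg hg).apply_apply_eq_zero v

theorem lTensor_injective_of_fg {N : Type} [AddCommGroup N] [Module A N] [Module.Flat A F]
    {j : K →ₗ[A] F}
    (h : ∀ N₀ : Submodule A N, N₀.FG → Function.Injective (j.lTensor N₀)) :
    Function.Injective (j.lTensor N) := by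
  rw [injective_iff_map_eq_zero]
  intro x hx
  obtain ⟨N₀, hN₀, hx₀⟩ :=
    TensorProduct.exists_finite_submodule_left_of_setFinite {x} (Set.finite_singleton x)
  obtain ⟨y, rfl⟩ := hx₀ rfl
  rw [lTensor_rTensor_apply] at hx
  have := (injective_iff_map_eq_zero _).1 (Module.Flat.rTensor_preserves_injective_linearMap
    (M := F) N₀.subtype N₀.subtype_injective) _ hx
  rw [(injective_iff_map_eq_zero _).1 (h N₀ (Module.Finite.iff_fg.1 hN₀)) _ this, map_zero]

theorem lTensor_injective_finsupp {ι N : Type} [AddCommGroup N] [Module A N]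
    {j : K →ₗ[A] F} (h : Function.Injective (j.lTensor N)) :
    Function.Injective (j.lTensor (ι →₀ N)) := by
  classical
  have key : (TensorProduct.finsuppLeft A A N F ι).toLinearMap ∘ₗ j.lTensor (ι →₀ N) =
      Finsupp.mapRange.linearMap (j.lTensor N) ∘ₗ
        (TensorProduct.finsuppLeft A A N K ι).toLinearMap := by
    ext i n k l
    simp
  have h2 : Function.Injective (Finsupp.mapRange.linearMap (α := ι) (j.lTensor N) ∘ₗ
        (TensorProduct.finsuppLeft A A N K ι).toLinearMap) :=
    (Finsupp.mapRange_injective _ (map_zero _) h).comp (LinearEquiv.injective _)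
  rw [← key, LinearMap.coe_comp] at h2
  exact Function.Injective.of_comp h2

end Presentation

section Fiber

theorem compatibleSMul_quotient {R : Type} [CommRing R] (I : Ideal R) (X Y : Type)
    [AddCommGroup X] [Module R X] [Module (R ⧸ I) X] [IsScalarTower R (R ⧸ I) X]
    [AddCommGroup Y] [Module R Y] [Module (R ⧸ I) Y] [IsScalarTower R (R ⧸ I) Y] :
    TensorProduct.CompatibleSMul R (R ⧸ I) X Y where
  smul_tmul d x y := by
    obtain ⟨r, rfl⟩ := Ideal.Quotient.mk_surjective d
    have hX : Ideal.Quotient.mk I r • x = r • x := algebraMap_smul (R ⧸ I) r x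
    have hY : Ideal.Quotient.mk I r • y = r • y := algebraMap_smul (R ⧸ I) r y
    rw [hX, hY, TensorProduct.smul_tmul]

variable {R : Type} [CommRing R] (p : Ideal R)

theorem rTensor_fractionRing_injective {X Y : Type} [AddCommGroup X] [Module R X]
    [AddCommGroup Y] [Module R Y] (hX : ∀ r ∈ p, ∀ x : X, r • x = 0)
    (hY : ∀ r ∈ p, ∀ y : Y, r • y = 0) (f : X →ₗ[R] Y) (hf : Function.Injective f) :
    Function.Injective (f.rTensor (FractionRing (R ⧸ p))) := by
  let _ : Module (R ⧸ p) X := Module.IsTorsionBySet.module (I := p) (fun x r => hX r r.2 x)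
  let _ : Module (R ⧸ p) Y := Module.IsTorsionBySet.module (I := p) (fun x r => hY r r.2 x)
  have : IsScalarTower R (R ⧸ p) X := Module.IsTorsionBySet.isScalarTower _
  have : IsScalarTower R (R ⧸ p) Y := Module.IsTorsionBySet.isScalarTower _
  let k := FractionRing (R ⧸ p)
  have := compatibleSMul_quotient p X k
  have := compatibleSMul_quotient p Y k
  let f' : X →ₗ[R ⧸ p] Y :=
    { f with map_smul' := by
              rintro ⟨r⟩ x
              exact f.map_smul r x }
  have h := Module.Flat.rTensor_preserves_injective_linearMap (M := k) f' hf
  have key : ∀ z, (TensorProduct.equivOfCompatibleSMul R (R ⧸ p) R Y k).symm (f.rTensor k z) =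
      f'.rTensor k ((TensorProduct.equivOfCompatibleSMul R (R ⧸ p) R X k).symm z) := by
    intro z
    induction z with
    | zero => simp
    | add x y hx hy => simp only [map_add, hx, hy]
    | tmul x y => rfl
  intro a b hab
  apply (TensorProduct.equivOfCompatibleSMul R (R ⧸ p) R X k).symm.injective
  apply h
  rw [← key, ← key, hab]

theorem eq_zero_of_tmul_one_fractionRing [p.IsPrime] {X : Type} [AddCommGroup X] [Module R X]
    (hX : ∀ r ∈ p, ∀ x : X, r • x = 0) (htf : ∀ r ∉ p, ∀ x : X, r • x = 0 → x = 0)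
    (x : X) (hx : x ⊗ₜ[R] (1 : FractionRing (R ⧸ p)) = 0) : x = 0 := by
  let _ : Module (R ⧸ p) X := Module.IsTorsionBySet.module (I := p) (fun x r => hX r r.2 x)
  have : IsScalarTower R (R ⧸ p) X := Module.IsTorsionBySet.isScalarTower _
  let k := FractionRing (R ⧸ p)
  have := compatibleSMul_quotient p X k
  have h1 : (1 : k) ⊗ₜ[R ⧸ p] x = 0 := by
    have := congrArg (TensorProduct.equivOfCompatibleSMul R (R ⧸ p) R X k).symm hx
    have h2 : x ⊗ₜ[R ⧸ p] (1 : k) = 0 := this.trans (map_zero _)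
    simpa using congrArg (TensorProduct.comm (R ⧸ p) X k) h2
  have h3 := (IsLocalizedModule.eq_zero_iff (nonZeroDivisors (R ⧸ p))
    (TensorProduct.mk (R ⧸ p) k X 1)).1 h1
  obtain ⟨⟨d, hd⟩, hdx⟩ := h3
  obtain ⟨r, rfl⟩ := Ideal.Quotient.mk_surjective d
  refine htf r (fun hr => ?_) x hdx
  exact nonZeroDivisors.ne_zero hd (Ideal.Quotient.eq_zero_iff_mem.2 hr)

/-- An injection of modules over `A/pA` stays injective after tensoring with `M` if the fiber of `M`
at `p` is flat and the source of the tensored map is torsion-free over `R/p`. -/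
theorem rTensor_injective_of_flat_fiber {A M L P : Type} [CommRing A] [Algebra R A]
    [AddCommGroup M] [Module A M] [AddCommGroup L] [Module A L] [AddCommGroup P] [Module A P]
    [p.IsPrime]
    (hM : Module.Flat (A ⊗[R] FractionRing (R ⧸ p)) ((A ⊗[R] FractionRing (R ⧸ p)) ⊗[A] M))
    (hL : ∀ r ∈ p, ∀ x : L, algebraMap R A r • x = 0)
    (hP : ∀ r ∈ p, ∀ x : P, algebraMap R A r • x = 0)
    (htf : ∀ r ∉ p, ∀ x : L ⊗[A] M, algebraMap R A r • x = 0 → x = 0)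
    (f : L →ₗ[A] P) (hf : Function.Injective f) :
    Function.Injective (f.rTensor M) := by
  let k := FractionRing (R ⧸ p)
  let B := A ⊗[R] k
  let _ : Module R L := Module.compHom L (algebraMap R A)
  let _ : Module R P := Module.compHom P (algebraMap R A)
  have : IsScalarTower R A L := .of_algebraMap_smul fun _ _ => rfl
  have : IsScalarTower R A P := .of_algebraMap_smul fun _ _ => rfl
  have : IsScalarTower R A (L ⊗[A] M) := .of_algebraMap_smul fun r x => by
    induction x with
    | zero => simp
    | add x y hx hy => simp only [smul_add, hx, hy]
    | tmul x y => rfl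
  have hBf : Function.Injective (f.baseChange B) := by
    have h := rTensor_fractionRing_injective p hL hP (f.restrictScalars R) hf
    have key : ∀ z, (AlgebraTensorModule.cancelBaseChange R A A P k)
        (TensorProduct.comm A B P (f.baseChange B z)) =
        (f.restrictScalars R).rTensor k ((AlgebraTensorModule.cancelBaseChange R A A L k)
          (TensorProduct.comm A B L z)) := by
      intro z
      induction z with
      | zero => simp
      | add x y hx hy => simp only [map_add, hx, hy]
      | tmul b x =>
        induction b using TensorProduct.induction_on with
        | zero => simp
        | add a b ha hb => simp only [add_tmul, map_add, ha, hb]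
        | tmul a c => exact (congrArg (· ⊗ₜ[R] c) (f.map_smul a x)).symm
    intro a b hab
    apply (TensorProduct.comm A B L).injective
    apply (AlgebraTensorModule.cancelBaseChange R A A L k).injective
    apply h
    rw [← key, ← key, hab]
  have hBM := Module.Flat.rTensor_preserves_injective_linearMap (M := B ⊗[A] M) (f.baseChange B) hBf
  have key : ∀ z, (f.baseChange B).rTensor (B ⊗[A] M)
      (AlgebraTensorModule.distribBaseChange A B L M z) =
      AlgebraTensorModule.distribBaseChange A B P M ((f.rTensor M).baseChange B z) := by
    intro z
    induction z with
    | zero => simp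
    | add x y hx hy => simp only [map_add, hx, hy]
    | tmul b x =>
      induction x with
      | zero => simp
      | add x y hx hy => simp only [tmul_add, map_add, hx, hy]
      | tmul x y => simp [LinearMap.baseChange_tmul]
  rw [injective_iff_map_eq_zero]
  intro x hx
  have h1 : (1 : B) ⊗ₜ[A] x = 0 := by
    apply (AlgebraTensorModule.distribBaseChange A B L M).injective
    apply hBM
    rw [key, LinearMap.baseChange_tmul, hx, tmul_zero]
    simp
  refine eq_zero_of_tmul_one_fractionRing p (X := L ⊗[A] M) ?_ ?_ x ?_
  · intro r hr x
    induction x with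
    | zero => simp
    | add x y hx hy => rw [smul_add, hx, hy, add_zero]
    | tmul x y => exact (congrArg (· ⊗ₜ[A] y) (hL r hr x)).trans (zero_tmul _ _)
  · intro r hr x hx
    refine htf r hr x ?_
    rwa [algebraMap_smul]
  · have := congrArg (AlgebraTensorModule.cancelBaseChange R A A (L ⊗[A] M) k)
      (congrArg (TensorProduct.comm A B (L ⊗[A] M)) h1)
    simpa [B, Algebra.TensorProduct.one_def] using this

end Fiber

/-- A flat cover `g : F → M` such that, whenever `Tor₁(N, M)` vanishes, tensoring `ker g → F` with
`N` preserves injectivity. -/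
theorem exists_flat_presentation_of_tor (A M : Type) [CommRing A] [AddCommGroup M] [Module A M] :
    ∃ (F : ModuleCat.{0} A) (g : F →ₗ[A] M), Module.Flat A F ∧ Function.Surjective g ∧
      ∀ (N : Type) [AddCommGroup N] [Module A N],
        Subsingleton (((Tor (ModuleCat A) 1).obj (ModuleCat.of A N)).obj (ModuleCat.of A M)) →
        Function.Injective ((LinearMap.ker g).subtype.lTensor N) := by
  let P := projectiveResolution (ModuleCat.of A M)
  let π : P.complex.X 0 ⟶ ModuleCat.of A M := P.π.f 0
  have hπ : Function.Surjective π := (ModuleCat.epi_iff_surjective (P.π.f 0)).1 inferInstance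
  have hex : Function.Exact (P.complex.d 1 0).hom π.hom :=
    (ShortComplex.ShortExact.moduleCat_exact_iff_function_exact _).1 P.exact₀
  have hproj : ∀ n, Module.Projective A (P.complex.X n) := fun n =>
    (IsProjective.iff_projective (P.complex.X n)).2 (P.projective n)
  refine ⟨P.complex.X 0, π.hom, inferInstance, hπ, ?_⟩
  intro N _ _ hN
  have hz : Limits.IsZero
      (((Tor (ModuleCat A) 1).obj (ModuleCat.of A N)).obj (ModuleCat.of A M)) :=
    ModuleCat.isZero_of_subsingleton _
  let G := (MonoidalCategory.tensoringLeft (ModuleCat A)).obj (ModuleCat.of A N)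
  have he : ((G.mapHomologicalComplex (ComplexShape.down ℕ)).obj P.complex).ExactAt 1 := by
    rw [HomologicalComplex.exactAt_iff_isZero_homology]
    exact hz.of_iso (P.isoLeftDerivedObj G 1).symm
  rw [HomologicalComplex.exactAt_iff' _ 2 1 0 (by simp) (by simp)] at he
  have he' : Function.Exact ((P.complex.d 2 1).hom.lTensor N) ((P.complex.d 1 0).hom.lTensor N) :=
    (ShortComplex.ShortExact.moduleCat_exact_iff_function_exact _).1 he
  let e : P.complex.X 1 →ₗ[A] LinearMap.ker π.hom :=
    (P.complex.d 1 0).hom.codRestrict _ fun x => hex.apply_apply_eq_zero x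
  have hes : Function.Surjective e := by
    rintro ⟨y, hy⟩
    obtain ⟨x, rfl⟩ := (hex y).1 hy
    exact ⟨x, rfl⟩
  have hcomp : (LinearMap.ker π.hom).subtype ∘ₗ e = (P.complex.d 1 0).hom := rfl
  have hed : e ∘ₗ (P.complex.d 2 1).hom = 0 := by
    ext x
    exact congrArg (fun f => f.hom x) (P.complex.d_comp_d 2 1 0)
  rw [injective_iff_map_eq_zero]
  intro x hx
  obtain ⟨y, rfl⟩ := LinearMap.lTensor_surjective N hes x
  rw [← LinearMap.comp_apply, ← LinearMap.lTensor_comp, hcomp] at hx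
  obtain ⟨z, rfl⟩ := (he' y).1 hx
  rw [← LinearMap.comp_apply, ← LinearMap.lTensor_comp, hed, LinearMap.lTensor_zero,
    LinearMap.zero_apply]

section Domain

variable {R A : Type} [CommRing R] [CommRing A] [Algebra R A] (p : Ideal R) [hp : p.IsPrime]

theorem exists_notMem_smul_eq_zero_of_fg {N : Type} [AddCommGroup N] [Module A N]
    (N₀ : Submodule A N) (hN₀ : N₀.FG) (ht : ∀ x ∈ N₀, ∃ r ∉ p, algebraMap R A r • x = 0) :
    ∃ r ∉ p, ∀ x ∈ N₀, algebraMap R A r • x = 0 := by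
  induction N₀, hN₀ using Submodule.fg_induction with
  | singleton x =>
    obtain ⟨r, hr, hrx⟩ := ht x (Submodule.mem_span_singleton_self x)
    refine ⟨r, hr, fun y hy => ?_⟩
    obtain ⟨a, rfl⟩ := Submodule.mem_span_singleton.1 hy
    rw [smul_comm, hrx, smul_zero]
  | sup N₁ N₂ _ _ h₁ h₂ =>
    obtain ⟨r, hr, h₁⟩ := h₁ fun x hx => ht x (Submodule.mem_sup_left hx)
    obtain ⟨s, hs, h₂⟩ := h₂ fun x hx => ht x (Submodule.mem_sup_right hx)
    refine ⟨r * s, fun h => (hp.mem_or_mem h).elim hr hs, fun x hx => ?_⟩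
    obtain ⟨y, hy, z, hz, rfl⟩ := Submodule.mem_sup.1 hx
    rw [smul_add, map_mul, mul_smul, mul_smul, h₂ z hz, smul_comm, h₁ y hy]
    simp

theorem mem_relTorsion {N : Type} [AddCommGroup N] [Module A N] {x : N} :
    x ∈ relTorsion R p hp A (algebraMap R A) N ↔ ∃ r ∉ p, algebraMap R A r • x = 0 :=
  Iff.rfl

theorem eq_zero_of_smul_quotient_relTorsion {N : Type} [AddCommGroup N] [Module A N] {r : R}
    (hr : r ∉ p) (x : N ⧸ relTorsion R p hp A (algebraMap R A) N)
    (hx : algebraMap R A r • x = 0) : x = 0 := by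
  obtain ⟨x, rfl⟩ := Submodule.Quotient.mk_surjective _ x
  rw [← Submodule.Quotient.mk_smul, Submodule.Quotient.mk_eq_zero, mem_relTorsion] at hx
  obtain ⟨s, hs, hx⟩ := hx
  rw [Submodule.Quotient.mk_eq_zero, mem_relTorsion]
  refine ⟨s * r, fun h => (hp.mem_or_mem h).elim hs hr, ?_⟩
  rw [map_mul, mul_smul, hx]

theorem smul_quotient_map_eq_zero {I : Ideal R} {r : R} (hr : r ∈ I)
    (x : A ⧸ I.map (algebraMap R A)) : algebraMap R A r • x = 0 := by
  obtain ⟨x, rfl⟩ := Ideal.Quotient.mk_surjective x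
  exact Ideal.Quotient.eq_zero_iff_mem.2
    (Ideal.mul_mem_right _ _ (Ideal.mem_map_of_mem _ hr))

theorem smul_submodule_quotient_eq_zero {N : Type} [AddCommGroup N] [Module A N]
    (N₀ : Submodule A N) {a : A} (h : ∀ x : N, a • x = 0) (x : N ⧸ N₀) : a • x = 0 := by
  obtain ⟨x, rfl⟩ := Submodule.Quotient.mk_surjective _ x
  rw [← Submodule.Quotient.mk_smul, h, Submodule.Quotient.mk_zero]

variable {K F M : Type} [AddCommGroup K] [Module A K] [AddCommGroup F] [Module A F]
  [AddCommGroup M] [Module A M] [Module.Flat A F] {j : K →ₗ[A] F} {q : F →ₗ[A] M}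
  (hjq : Function.Exact j q) (hq : Function.Surjective q)
  (hT : ∀ r ∉ p, ∀ (N : Type) [AddCommGroup N] [Module A N],
    (∀ s ∈ p, ∀ x : N, algebraMap R A s • x = 0) → (∀ x : N, algebraMap R A r • x = 0) →
      Function.Injective (j.lTensor N))

include hT

theorem lTensor_injective_of_torsion {N : Type} [AddCommGroup N] [Module A N]
    (hN : ∀ s ∈ p, ∀ x : N, algebraMap R A s • x = 0)
    (ht : ∀ x : N, ∃ r ∉ p, algebraMap R A r • x = 0) :
    Function.Injective (j.lTensor N) := by
  refine lTensor_injective_of_fg fun N₀ hN₀ => ?_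
  obtain ⟨r, hr, h⟩ := exists_notMem_smul_eq_zero_of_fg p N₀ hN₀ fun x _ => ht x
  exact hT r hr N₀ (fun s hs x => Subtype.ext (hN s hs x)) (fun x => Subtype.ext (h x x.2))

include hjq hq

theorem lTensor_injective_torsionfree_of_isNoetherianRing [IsNoetherianRing A]
    (hA : Function.Injective (j.lTensor (A ⧸ p.map (algebraMap R A)))) :
    Function.Injective (j.lTensor ((A ⧸ p.map (algebraMap R A)) ⧸
      relTorsion R p hp A (algebraMap R A) (A ⧸ p.map (algebraMap R A)))) := by
  set A' := A ⧸ p.map (algebraMap R A)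
  set t := relTorsion R p hp A (algebraMap R A) A'
  refine lTensor_injective_of_rTensor_injective (f := t.subtype) (g := t.mkQ)
    (LinearMap.exact_subtype_mkQ t) t.mkQ_surjective hjq hq hA ?_
  obtain ⟨r, hr, hrt⟩ := exists_notMem_smul_eq_zero_of_fg p t (IsNoetherian.noetherian t)
    fun x hx => hx
  let D : Submodule A A' := LinearMap.range (LinearMap.lsmul A A' (algebraMap R A r))
  let f : t →ₗ[A] A' ⧸ D := D.mkQ ∘ₗ t.subtype
  have hf : Function.Injective f := by
    rw [injective_iff_map_eq_zero]
    rintro ⟨x, hx⟩ h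
    obtain ⟨y, hy⟩ : x ∈ D := (Submodule.Quotient.mk_eq_zero D).1 h
    change algebraMap R A r • y = x at hy
    have hyt : y ∈ t := by
      obtain ⟨s, hs, hsx⟩ := hx
      refine ⟨s * r, fun h => (hp.mem_or_mem h).elim hs hr, ?_⟩
      rw [map_mul, mul_smul, hy, hsx]
    exact Subtype.ext (hy.symm.trans (hrt y hyt))
  have h : Function.Injective (f.rTensor M) := by
    refine rTensor_injective_of_lTensor_injective hf (LinearMap.exact_map_mkQ_range f)
      (LinearMap.range f).mkQ_surjective hjq hq (hT r hr _ ?_ ?_)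
    · intro s hs
      exact smul_submodule_quotient_eq_zero _
        (smul_submodule_quotient_eq_zero _ (smul_quotient_map_eq_zero hs))
    · refine smul_submodule_quotient_eq_zero _ fun x => ?_
      obtain ⟨x, rfl⟩ := Submodule.Quotient.mk_surjective _ x
      exact (Submodule.Quotient.mk_eq_zero D).2 ⟨x, rfl⟩
  rw [LinearMap.rTensor_comp, LinearMap.coe_comp] at h
  exact Function.Injective.of_comp h

omit hp in
theorem eq_zero_of_smul_tmul {L : Type} [AddCommGroup L] [Module A L]
    (hL : ∀ s ∈ p, ∀ x : L, algebraMap R A s • x = 0)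
    (htf : ∀ r ∉ p, ∀ x : L, algebraMap R A r • x = 0 → x = 0) (r : R) (hr : r ∉ p)
    (x : L ⊗[A] M) (hx : algebraMap R A r • x = 0) : x = 0 := by
  let f := LinearMap.lsmul A L (algebraMap R A r)
  have hf : Function.Injective f := (injective_iff_map_eq_zero f).2 (htf r hr)
  have h := rTensor_injective_of_lTensor_injective hf (LinearMap.exact_map_mkQ_range f)
    (LinearMap.range f).mkQ_surjective hjq hq (hT r hr _
      (fun s hs => smul_submodule_quotient_eq_zero _ (hL s hs)) (by
        intro x
        obtain ⟨x, rfl⟩ := Submodule.Quotient.mk_surjective _ x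
        exact (Submodule.Quotient.mk_eq_zero _).2 ⟨x, rfl⟩))
  apply (injective_iff_map_eq_zero _).1 h
  rw [← hx]
  change (LinearMap.lsmul A L (algebraMap R A r)).rTensor M x = _
  rw [show LinearMap.lsmul A L (algebraMap R A r) = algebraMap R A r • LinearMap.id from rfl,
    LinearMap.rTensor_smul, LinearMap.smul_apply, LinearMap.rTensor_id, LinearMap.id_apply]

variable (hM : Module.Flat (A ⊗[R] FractionRing (R ⧸ p)) ((A ⊗[R] FractionRing (R ⧸ p)) ⊗[A] M))
  (hA : Function.Injective (j.lTensor ((A ⧸ p.map (algebraMap R A)) ⧸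
      relTorsion R p hp A (algebraMap R A) (A ⧸ p.map (algebraMap R A)))))

include hM hA

theorem lTensor_injective_of_torsionfree {N : Type} [AddCommGroup N] [Module A N]
    (hN : ∀ s ∈ p, ∀ x : N, algebraMap R A s • x = 0)
    (htf : ∀ r ∉ p, ∀ x : N, algebraMap R A r • x = 0 → x = 0) :
    Function.Injective (j.lTensor N) := by
  obtain ⟨P, _, _, g, hg, hP, hPtf, hPj⟩ : ∃ (P : Type) (_ : AddCommGroup P) (_ : Module A P)
      (g : P →ₗ[A] N), Function.Surjective g ∧ (∀ s ∈ p, ∀ x : P, algebraMap R A s • x = 0) ∧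
        (∀ r ∉ p, ∀ x : P, algebraMap R A r • x = 0 → x = 0) ∧
          Function.Injective (j.lTensor P) := by
    set t := relTorsion R p hp A (algebraMap R A) (A ⧸ p.map (algebraMap R A))
    have hpn : ∀ n : N,
        p.map (algebraMap R A) ≤ LinearMap.ker (LinearMap.toSpanSingleton A N n) :=
      fun n => Ideal.map_le_iff_le_comap.2 fun s hs => hN s hs n
    let φ : ∀ n : N, ((A ⧸ p.map (algebraMap R A)) ⧸ t) →ₗ[A] N := fun n =>
      t.liftQ (Submodule.liftQ _ (LinearMap.toSpanSingleton A N n) (hpn n)) (by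
        rintro x ⟨r, hr, hx⟩
        refine htf r hr _ ?_
        rw [← map_smul, hx, map_zero])
    have hφ : ∀ n, φ n (Submodule.Quotient.mk (Submodule.Quotient.mk 1)) = n := fun n =>
      one_smul A n
    refine ⟨N →₀ ((A ⧸ p.map (algebraMap R A)) ⧸ t), inferInstance, inferInstance,
      Finsupp.lsum A φ, fun n => ?_, fun s hs x => Finsupp.ext fun n => ?_,
      fun r hr x hx => Finsupp.ext fun n => ?_, lTensor_injective_finsupp hA⟩
    · exact ⟨Finsupp.single n (Submodule.Quotient.mk (Submodule.Quotient.mk 1)),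
        (Finsupp.lsum_single A φ n _).trans (hφ n)⟩
    · exact smul_submodule_quotient_eq_zero _ (smul_quotient_map_eq_zero hs) (x n)
    · exact eq_zero_of_smul_quotient_relTorsion p hr (x n) (DFunLike.congr_fun hx n)
  refine lTensor_injective_of_rTensor_injective (LinearMap.exact_subtype_ker_map g) hg hjq hq
    hPj ?_
  have hL : ∀ s ∈ p, ∀ x : LinearMap.ker g, algebraMap R A s • x = 0 :=
    fun s hs x => Subtype.ext (hP s hs x)
  refine rTensor_injective_of_flat_fiber p hM hL hP ?_ _ (Submodule.subtype_injective _)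
  exact eq_zero_of_smul_tmul p hjq hq hT hL fun r hr x hx =>
    Subtype.ext (hPtf r hr x (congrArg Subtype.val hx))

theorem lTensor_injective_of_smul_prime_eq_zero {N : Type} [AddCommGroup N] [Module A N]
    (hN : ∀ s ∈ p, ∀ x : N, algebraMap R A s • x = 0) :
    Function.Injective (j.lTensor N) := by
  let t := relTorsion R p hp A (algebraMap R A) N
  refine lTensor_injective_of_extension t.subtype_injective (LinearMap.exact_subtype_mkQ t)
    t.mkQ_surjective ?_ ?_
  · exact lTensor_injective_of_torsion p hT (fun s hs x => Subtype.ext (hN s hs x))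
      fun ⟨x, r, hr, hx⟩ => ⟨r, hr, Subtype.ext hx⟩
  · exact lTensor_injective_of_torsionfree p hjq hq hT hM hA
      (fun s hs => smul_submodule_quotient_eq_zero _ (hN s hs))
      fun r hr => eq_zero_of_smul_quotient_relTorsion p hr

end Domain

theorem lt_sup_span_singleton {R : Type} [CommRing R] {I : Ideal R} {c : R} (hc : c ∉ I) :
    I < I ⊔ Ideal.span {c} :=
  lt_of_le_of_ne le_sup_left fun h =>
    hc (h ▸ Ideal.mem_sup_right (Ideal.mem_span_singleton_self c))

theorem smul_eq_zero_of_mem_sup_span_singleton {R A X : Type} [CommRing R] [CommRing A]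
    [Algebra R A] [AddCommGroup X] [Module A X] {I : Ideal R} {c : R}
    (hI : ∀ s ∈ I, ∀ x : X, algebraMap R A s • x = 0) (hc : ∀ x : X, algebraMap R A c • x = 0) :
    ∀ s ∈ I ⊔ Ideal.span {c}, ∀ x : X, algebraMap R A s • x = 0 := by
  intro s hs x
  obtain ⟨y, hy, z, hz, rfl⟩ := Submodule.mem_sup.1 hs
  obtain ⟨w, rfl⟩ := Ideal.mem_span_singleton'.1 hz
  rw [map_add, add_smul, hI y hy, map_mul, mul_smul, hc, smul_zero, add_zero]

theorem lTensor_injective_of_not_isPrime {R A K F : Type} [CommRing R] [CommRing A] [Algebra R A]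
    [AddCommGroup K] [Module A K] [AddCommGroup F] [Module A F] [Module.Flat A F]
    {j : K →ₗ[A] F} {I : Ideal R} (hI : ¬ I.IsPrime)
    (hT : ∀ J > I, ∀ (N : Type) [AddCommGroup N] [Module A N],
      (∀ s ∈ J, ∀ x : N, algebraMap R A s • x = 0) → Function.Injective (j.lTensor N))
    {N : Type} [AddCommGroup N] [Module A N] (hN : ∀ s ∈ I, ∀ x : N, algebraMap R A s • x = 0) :
    Function.Injective (j.lTensor N) := by
  by_cases htop : I = ⊤
  · have hsub : Subsingleton N := subsingleton_of_forall_eq 0 fun x => by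
      simpa using hN 1 (htop ▸ Submodule.mem_top) x
    exact Function.injective_of_subsingleton _
  obtain ⟨a, ha, b, hb, hab⟩ : ∃ a, a ∉ I ∧ ∃ b, b ∉ I ∧ a * b ∈ I := by
    by_contra! h
    refine hI ⟨htop, fun {x y} hxy => ?_⟩
    by_contra! hn
    exact h x hn.1 y hn.2 hxy
  let f := LinearMap.lsmul A N (algebraMap R A a)
  refine lTensor_injective_of_extension (LinearMap.range f).subtype_injective
    (LinearMap.exact_subtype_mkQ _) (LinearMap.range f).mkQ_surjective ?_ ?_
  · refine hT _ (lt_sup_span_singleton hb) _ (smul_eq_zero_of_mem_sup_span_singleton (fun s hs x => Subtype.ext (hN s hs x)) ?_)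
    rintro ⟨_, x, rfl⟩
    refine Subtype.ext ?_
    change algebraMap R A b • algebraMap R A a • x = 0
    rw [smul_smul, ← map_mul, mul_comm, hN _ hab]
  · refine hT _ (lt_sup_span_singleton ha) _ (smul_eq_zero_of_mem_sup_span_singleton
      (fun s hs => smul_submodule_quotient_eq_zero _ (hN s hs)) fun x => ?_)
    obtain ⟨x, rfl⟩ := Submodule.Quotient.mk_surjective _ x
    exact (Submodule.Quotient.mk_eq_zero _).2 ⟨x, rfl⟩

theorem flatness_criterion_F1_F2_F3
    (R A M : Type) [CommRing R] [IsNoetherianRing R] [CommRing A] [Algebra R A]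
    [AddCommGroup M] [Module A M]
    (F1 : ∀ l : Ideal R,
      Subsingleton (((Tor (ModuleCat A) 1).obj
          (ModuleCat.of A (A ⧸ Ideal.map (algebraMap R A) l))).obj (ModuleCat.of A M)))
    (F2 : ∀ (p : Ideal R) [p.IsPrime],
      Module.Flat (A ⊗[R] FractionRing (R ⧸ p)) ((A ⊗[R] FractionRing (R ⧸ p)) ⊗[A] M))
    (F3 : IsNoetherianRing A ∨
      ∀ (p : Ideal R) [hp : p.IsPrime],
        Subsingleton (((Tor (ModuleCat A) 1).obj
          (ModuleCat.of A ((A ⧸ Ideal.map (algebraMap R A) p) ⧸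
            relTorsion R p hp A (algebraMap R A)
              (A ⧸ Ideal.map (algebraMap R A) p)))).obj (ModuleCat.of A M))) :
    Module.Flat A M := by
  obtain ⟨F, q, hF, hq, hTor⟩ := exists_flat_presentation_of_tor A M
  have hjq : Function.Exact (LinearMap.ker q).subtype q := LinearMap.exact_subtype_ker_map q
  have main : ∀ (I : Ideal R) (N : Type) [AddCommGroup N] [Module A N],
      (∀ s ∈ I, ∀ x : N, algebraMap R A s • x = 0) →
        Function.Injective ((LinearMap.ker q).subtype.lTensor N) := by
    intro I
    induction I using WellFoundedGT.induction with
    | ind I ih =>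
    intro N _ _ hN
    by_cases hI : I.IsPrime
    · have hT : ∀ r ∉ I, ∀ (N : Type) [AddCommGroup N] [Module A N],
          (∀ s ∈ I, ∀ x : N, algebraMap R A s • x = 0) → (∀ x : N, algebraMap R A r • x = 0) →
            Function.Injective ((LinearMap.ker q).subtype.lTensor N) := by
        intro r hr N _ _ hN hrN
        exact ih _ (lt_sup_span_singleton hr) N (smul_eq_zero_of_mem_sup_span_singleton hN hrN)
      refine lTensor_injective_of_smul_prime_eq_zero I hjq hq hT (F2 I) ?_ hN
      rcases F3 with hA | h
      · exact lTensor_injective_torsionfree_of_isNoetherianRing I hjq hq hT (hTor _ (F1 I))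
      · exact hTor _ (h I)
    · exact lTensor_injective_of_not_isPrime hI ih hN
  rw [Module.Flat.iff_rTensor_preserves_injective_linearMap]
  intro N N' _ _ _ _ f hf
  exact rTensor_injective_of_lTensor_injective hf (LinearMap.exact_map_mkQ_range f)
    (LinearMap.range f).mkQ_surjective hjq hq
    (main ⊥ _ fun s hs x => by simp [(Submodule.mem_bot R).1 hs])
end

section
/- Let R be a commutative noetherian ring, f : R → A a ring homomorphism, and M an A-module. Then M is a flat A-module if and only if for every prime ideal p of R the following two conditions hold: (i) Tor_1^A(A/pA, M) = 0 and Tor_1^A((A/pA)_tf, M) = 0; (ii) the (A ⊗_R k(p))-module M ⊗_R k(p) is flat. -/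
/-!
Corollary 4.6 (full fiber criterion for flatness): let `R` be noetherian, `R → A` a ring map
and `M` an `A`-module.  Then `M` is flat over `A` if and only if for every prime `p` of `R`:
(i) `Tor₁^A(A/pA, M) = 0` and `Tor₁^A((A/pA)_tf, M) = 0`, where `(A/pA)_tf` is the quotient of
`A/pA` by its `R/p`-torsion submodule;
(ii) the fiber `M ⊗_R k(p)` is a flat `A ⊗_R k(p)`-module (realized as the base change
`(A ⊗[R] k(p)) ⊗[A] M`, with `k(p) = Frac(R ⧸ p)`).
-/

set_option synthInstance.maxHeartbeats 1000000

open TensorProduct CategoryTheory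

universe u

/-- `Tor₁ᴬ(X, M)` is computed by a flat module surjecting onto `M`. -/
theorem exists_flat_surjection_tor_iff (A M : Type u) [CommRing A] [AddCommGroup M] [Module A M] :
    ∃ (F : Type u) (_ : AddCommGroup F) (_ : Module A F) (π : F →ₗ[A] M),
      Module.Flat A F ∧ Function.Surjective π ∧
      ∀ (X : Type u) [AddCommGroup X] [Module A X],
        Subsingleton (((Tor (ModuleCat A) 1).obj (ModuleCat.of A X)).obj (ModuleCat.of A M)) ↔
          Function.Injective ((LinearMap.ker π).subtype.lTensor X) := by
  let P := ProjectiveResolution.of (ModuleCat.of A M)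
  let d₁ := (P.complex.d 1 0).hom
  let d₂ := (P.complex.d 2 1).hom
  let π : P.complex.X 0 →ₗ[A] M := (P.π.f 0).hom
  have hd₂ : Function.Exact d₂ d₁ :=
    (ShortComplex.ShortExact.moduleCat_exact_iff_function_exact _).mp (P.exact_succ 0)
  have hd₁ : Function.Exact d₁ π :=
    (ShortComplex.ShortExact.moduleCat_exact_iff_function_exact _).mp P.exact₀
  have : Projective (P.complex.X 0) := P.projective 0
  have : Module.Projective A (P.complex.X 0) :=
    (IsProjective.iff_projective _).mpr ‹_›
  refine ⟨P.complex.X 0, inferInstance, inferInstance, π, inferInstance,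
    (ModuleCat.epi_iff_surjective (P.π.f 0)).mp inferInstance, fun X _ _ => ?_⟩
  let e : P.complex.X 1 →ₗ[A] LinearMap.ker π :=
    d₁.codRestrict _ fun x => (hd₁ _).mpr ⟨x, rfl⟩
  have he : Function.Surjective e := by
    rintro ⟨y, hy⟩
    obtain ⟨x, rfl⟩ := (hd₁ y).mp hy
    exact ⟨x, rfl⟩
  have hed : Function.Exact d₂ e := fun x => by
    rw [← hd₂ x, ← Subtype.coe_inj]
    rfl
  have key : Subsingleton (((Tor (ModuleCat A) 1).obj (ModuleCat.of A X)).obj (ModuleCat.of A M)) ↔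
      Function.Exact (d₂.lTensor X) (d₁.lTensor X) := by
    rw [← ModuleCat.isZero_iff_subsingleton]
    refine (P.isoLeftDerivedObj ((MonoidalCategory.tensoringLeft (ModuleCat A)).obj
      (.of A X)) 1).isZero_iff.trans ?_
    refine (HomologicalComplex.exactAt_iff_isZero_homology _ _).symm.trans ?_
    rw [HomologicalComplex.exactAt_iff' _ 2 1 0 (by simp) (by simp)]
    exact ShortComplex.ShortExact.moduleCat_exact_iff_function_exact _
  have hX := lTensor_exact X hed he
  have hsurj := LinearMap.lTensor_surjective X he
  have hcomp : d₁.lTensor X = (LinearMap.ker π).subtype.lTensor X ∘ₗ e.lTensor X := by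
    rw [← LinearMap.lTensor_comp]
    rfl
  rw [key, hcomp]
  constructor
  · intro h
    rw [injective_iff_map_eq_zero]
    intro y hy
    obtain ⟨x, rfl⟩ := hsurj y
    exact (hX x).mpr ((h x).mp hy)
  · intro h x
    rw [← hX x, LinearMap.comp_apply, map_eq_zero_iff _ h]

section
variable {A M F : Type u} [CommRing A] [AddCommGroup M] [Module A M]
    [AddCommGroup F] [Module A F] (π : F →ₗ[A] M)

/-- Given `π : F → M`, an `A`-module `X` is transverse to `π` if tensoring with `X` preserves
injectivity of `ker π → F`; if `π` is surjective and `F` is flat this says `Tor₁ᴬ(X, M) = 0`. -/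
def IsTransverse (X : Type u) [AddCommGroup X] [Module A X] : Prop :=
  Function.Injective ((LinearMap.ker π).subtype.lTensor X)

namespace IsTransverse

variable {π} {X Y Z : Type u} [AddCommGroup X] [Module A X] [AddCommGroup Y] [Module A Y]
  [AddCommGroup Z] [Module A Z]

lemma rTensor_comm {P Q : Type u} [AddCommGroup P] [Module A P] [AddCommGroup Q] [Module A Q]
    (f : X →ₗ[A] Y) (g : P →ₗ[A] Q) (t : X ⊗[A] P) :
    f.rTensor Q (g.lTensor X t) = g.lTensor Y (f.rTensor P t) := by
  simp only [← LinearMap.comp_apply, LinearMap.rTensor_comp_lTensor, LinearMap.lTensor_comp_rTensor]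

lemma of_exact [Module.Flat A F] {f : X →ₗ[A] Y} {g : Y →ₗ[A] Z} (hf : Function.Injective f)
    (hfg : Function.Exact f g) (hg : Function.Surjective g)
    (hX : IsTransverse π X) (hZ : IsTransverse π Z) : IsTransverse π Y := by
  refine (injective_iff_map_eq_zero _).mpr fun y hy => ?_
  have hz : g.rTensor _ y = 0 := (injective_iff_map_eq_zero _).mp hZ _ <| by
    rw [← rTensor_comm, hy, map_zero]
  obtain ⟨x, rfl⟩ := (rTensor_exact _ hfg hg y).mp hz
  rw [← rTensor_comm] at hy
  have hx := (injective_iff_map_eq_zero _).mp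
    (Module.Flat.rTensor_preserves_injective_linearMap (M := F) f hf) _ hy
  rw [(injective_iff_map_eq_zero _).mp hX _ hx, map_zero]

lemma of_fg [Module.Flat A F] (h : ∀ N : Submodule A X, N.FG → IsTransverse π N) :
    IsTransverse π X := by
  refine (injective_iff_map_eq_zero _).mpr fun x hx => ?_
  obtain ⟨N, hN, hxN⟩ :=
    TensorProduct.exists_finite_submodule_left_of_setFinite {x} (Set.finite_singleton x)
  obtain ⟨y, rfl⟩ := hxN rfl
  rw [← rTensor_comm] at hx
  have hy := (injective_iff_map_eq_zero _).mp
    (Module.Flat.rTensor_preserves_injective_linearMap (M := F) N.subtype N.subtype_injective) _ hx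
  rw [(injective_iff_map_eq_zero _).mp (h N (Module.Finite.iff_fg.mp hN)) _ hy, map_zero]

lemma finsupp (ι : Type u) (h : IsTransverse π X) : IsTransverse π (ι →₀ X) := by
  classical
  refine (injective_iff_map_eq_zero _).mpr fun x hx => ?_
  apply (TensorProduct.finsuppLeft A A X _ ι).injective
  ext i
  rw [TensorProduct.finsuppLeft_apply, map_zero, Finsupp.zero_apply]
  apply (injective_iff_map_eq_zero _).mp h
  rw [← rTensor_comm, hx, map_zero]

lemma rTensor_injective [Module.Flat A F] (hπ : Function.Surjective π)
    {f : X →ₗ[A] Y} {g : Y →ₗ[A] Z} (hf : Function.Injective f)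
    (hfg : Function.Exact f g) (hg : Function.Surjective g)
    (hZ : IsTransverse π Z) : Function.Injective (f.rTensor M) := by
  have hker : Function.Exact (LinearMap.ker π).subtype π := LinearMap.exact_subtype_ker_map π
  refine (injective_iff_map_eq_zero _).mpr fun w hw => ?_
  obtain ⟨z, rfl⟩ := LinearMap.lTensor_surjective X hπ w
  rw [rTensor_comm] at hw
  obtain ⟨y, hy⟩ := (lTensor_exact Y hker hπ _).mp hw
  have hgy : g.rTensor _ y = 0 := (injective_iff_map_eq_zero _).mp hZ _ <| by
    rw [← rTensor_comm, hy, ← LinearMap.comp_apply, ← LinearMap.rTensor_comp,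
      hfg.linearMap_comp_eq_zero, LinearMap.rTensor_zero, LinearMap.zero_apply]
  obtain ⟨z', rfl⟩ := (rTensor_exact _ hfg hg y).mp hgy
  rw [← rTensor_comm] at hy
  rw [← Module.Flat.rTensor_preserves_injective_linearMap (M := F) f hf hy]
  exact (lTensor_exact X hker hπ _).mpr ⟨z', rfl⟩

lemma of_rTensor_injective (hπ : Function.Surjective π)
    {f : X →ₗ[A] Y} {g : Y →ₗ[A] Z}
    (hfg : Function.Exact f g) (hg : Function.Surjective g)
    (hY : IsTransverse π Y) (hM : Function.Injective (f.rTensor M)) : IsTransverse π Z := by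
  have hker : Function.Exact (LinearMap.ker π).subtype π := LinearMap.exact_subtype_ker_map π
  refine (injective_iff_map_eq_zero _).mpr fun x hx => ?_
  obtain ⟨y, rfl⟩ := LinearMap.rTensor_surjective _ hg x
  rw [← rTensor_comm] at hx
  obtain ⟨z, hz⟩ := (rTensor_exact _ hfg hg _).mp hx
  have hz0 : π.lTensor X z = 0 := (injective_iff_map_eq_zero _).mp hM _ <| by
    rw [rTensor_comm, hz]
    exact (lTensor_exact Y hker hπ _).mpr ⟨y, rfl⟩
  obtain ⟨z', rfl⟩ := (lTensor_exact X hker hπ _).mp hz0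
  rw [rTensor_comm] at hz
  rw [← hY hz]
  exact (rTensor_exact _ hfg hg _).mpr ⟨z', rfl⟩

end IsTransverse
end

lemma lTensor_rTensor_injective_of_flat_baseChange {A S V W M : Type*} [CommRing A] [CommRing S]
    [Algebra A S] [AddCommGroup V] [Module A V] [AddCommGroup W] [Module A W]
    [AddCommGroup M] [Module A M] [Module.Flat S (S ⊗[A] M)]
    (f : V →ₗ[A] W) (hf : Function.Injective (f.lTensor S)) :
    Function.Injective ((f.rTensor M).lTensor S) := by
  have hnat (y : S ⊗[A] (V ⊗[A] M)) :
      AlgebraTensorModule.distribBaseChange A S W M ((f.rTensor M).lTensor S y) =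
        (f.baseChange S).rTensor (S ⊗[A] M)
          (AlgebraTensorModule.distribBaseChange A S V M y) := by
    induction y with
    | zero => simp
    | add y z hy hz => rw [map_add, map_add, hy, hz, map_add, map_add]
    | tmul s z =>
      induction z with
      | zero => simp
      | add y z hy hz => rw [TensorProduct.tmul_add, map_add, map_add, hy, hz, map_add, map_add]
      | tmul v m => simp
  have hinj := Module.Flat.rTensor_preserves_injective_linearMap (M := S ⊗[A] M)
    (f.baseChange S) hf
  refine (injective_iff_map_eq_zero _).mpr fun y hy => ?_
  rw [← map_eq_zero_iff _ (AlgebraTensorModule.distribBaseChange A S V M).injective,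
    ← map_eq_zero_iff _ hinj, ← hnat, hy, map_zero]

section
variable {R A : Type u} [CommRing R] [CommRing A] [Algebra R A] {p : Ideal R} [hp : p.IsPrime]

lemma exists_smul_eq_one_tmul_fractionRing_quotient {V : Type u} [AddCommGroup V] [Module R V]
    (z : FractionRing (R ⧸ p) ⊗[R] V) : ∃ r ∉ p, ∃ v : V, r • z = 1 ⊗ₜ v := by
  induction z with
  | zero => exact ⟨1, p.one_notMem, 0, by simp⟩
  | tmul a v =>
    obtain ⟨⟨b, s⟩, h⟩ := IsLocalization.surj (nonZeroDivisors (R ⧸ p)) a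
    obtain ⟨b, rfl⟩ := Ideal.Quotient.mk_surjective b
    obtain ⟨s, hs⟩ := s
    obtain ⟨s, rfl⟩ := Ideal.Quotient.mk_surjective s
    refine ⟨s, fun h => nonZeroDivisors.ne_zero hs (Ideal.Quotient.eq_zero_iff_mem.mpr h),
      b • v, ?_⟩
    have h' : s • a = b • (1 : FractionRing (R ⧸ p)) := by
      rw [Algebra.smul_def, Algebra.smul_def, mul_one, mul_comm]
      exact h
    rw [← TensorProduct.smul_tmul, ← h', TensorProduct.smul_tmul']
  | add x y hx hy =>
    obtain ⟨r, hr, v, hv⟩ := hx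
    obtain ⟨s, hs, w, hw⟩ := hy
    refine ⟨r * s, fun h => (hp.mem_or_mem h).elim hr hs, s • v + r • w, ?_⟩
    rw [smul_add, mul_comm, mul_smul, hv, mul_comm, mul_smul, hw, TensorProduct.tmul_add,
      TensorProduct.tmul_smul, TensorProduct.tmul_smul]

lemma exists_smul_eq_zero_of_one_tmul_eq_zero {V : Type u} [AddCommGroup V] [Module R V]
    (hV : ∀ r ∈ p, ∀ v : V, r • v = 0) (v : V)
    (h : (1 : FractionRing (R ⧸ p)) ⊗ₜ[R] v = 0) : ∃ r ∉ p, r • v = 0 := by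
  let _ : Module (R ⧸ p) V := (show Module.IsTorsionBySet R V p from fun v r => hV r r.2 v).module
  have : IsScalarTower R (R ⧸ p) V := Module.IsTorsionBySet.isScalarTower _
  have h' : (1 : FractionRing (R ⧸ p)) ⊗ₜ[R ⧸ p] v = 0 := by
    have := congrArg
      (TensorProduct.mapOfCompatibleSMul (R ⧸ p) R (R ⧸ p) (FractionRing (R ⧸ p)) V) h
    simpa using this
  have := (isLocalizedModule_iff_isBaseChange (nonZeroDivisors (R ⧸ p)) (FractionRing (R ⧸ p))
    (TensorProduct.mk (R ⧸ p) (FractionRing (R ⧸ p)) V 1)).mpr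
      (TensorProduct.isBaseChange _ _ _)
  obtain ⟨⟨c, hcm⟩, hc⟩ := IsLocalizedModule.exists_of_eq (S := nonZeroDivisors (R ⧸ p))
    (f := TensorProduct.mk (R ⧸ p) (FractionRing (R ⧸ p)) V 1) (x₁ := v) (x₂ := 0)
    (by simpa using h')
  obtain ⟨c, rfl⟩ := Ideal.Quotient.mk_surjective c
  refine ⟨c, fun h => nonZeroDivisors.ne_zero hcm (Ideal.Quotient.eq_zero_iff_mem.mpr h), ?_⟩
  rw [smul_zero] at hc
  exact hc

variable {V W : Type u} [AddCommGroup V] [Module R V] [Module A V] [IsScalarTower R A V]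
  [AddCommGroup W] [Module R W] [Module A W] [IsScalarTower R A W]

lemma exists_smul_eq_zero_of_one_tmul_fiber_eq_zero
    (hV : ∀ r ∈ p, ∀ v : V, r • v = 0) (v : V)
    (h : (1 : A ⊗[R] FractionRing (R ⧸ p)) ⊗ₜ[A] v = 0) : ∃ r ∉ p, r • v = 0 := by
  refine exists_smul_eq_zero_of_one_tmul_eq_zero hV v ?_
  have := congrArg (TensorProduct.comm R _ _ ∘
    AlgebraTensorModule.cancelBaseChange R A A V (FractionRing (R ⧸ p)) ∘
      TensorProduct.comm A _ _) h
  simpa [Algebra.TensorProduct.one_def] using this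

lemma isUnit_algebraMap_fiber {r : R} (hr : r ∉ p) :
    IsUnit (algebraMap R (A ⊗[R] FractionRing (R ⧸ p)) r) := by
  rw [← (Algebra.TensorProduct.includeRight :
    FractionRing (R ⧸ p) →ₐ[R] A ⊗[R] FractionRing (R ⧸ p)).commutes r]
  refine IsUnit.map _ (IsUnit.mk0 _ ?_)
  rwa [IsScalarTower.algebraMap_apply R (R ⧸ p), Ne,
    IsFractionRing.to_map_eq_zero_iff, Ideal.Quotient.algebraMap_eq,
    Ideal.Quotient.eq_zero_iff_mem]

lemma exists_smul_eq_one_tmul_fiber (z : (A ⊗[R] FractionRing (R ⧸ p)) ⊗[A] V) :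
    ∃ r ∉ p, ∃ v : V, r • z = 1 ⊗ₜ v := by
  obtain ⟨r, hr, v, hv⟩ := exists_smul_eq_one_tmul_fractionRing_quotient (p := p)
    ((TensorProduct.comm R _ _ ∘
    AlgebraTensorModule.cancelBaseChange R A A V (FractionRing (R ⧸ p)) ∘
      TensorProduct.comm A _ _) z)
  refine ⟨r, hr, v, (TensorProduct.comm A _ _).injective <|
    (AlgebraTensorModule.cancelBaseChange R A A V (FractionRing (R ⧸ p))).injective <|
      (TensorProduct.comm R _ _).injective ?_⟩
  have h (y : (A ⊗[R] FractionRing (R ⧸ p)) ⊗[A] V) : r • y = algebraMap R A r • y :=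
    (algebraMap_smul A r y).symm
  have h' (y : V ⊗[R] FractionRing (R ⧸ p)) : algebraMap R A r • y = r • y :=
    algebraMap_smul A r y
  rw [h, map_smul, map_smul, h', map_smul]
  simpa [Algebra.TensorProduct.one_def] using hv

lemma lTensor_fiber_injective (hW : ∀ r ∈ p, ∀ w : W, r • w = 0)
    {f : V →ₗ[A] W} (hf : Function.Injective f) :
    Function.Injective (f.lTensor (A ⊗[R] FractionRing (R ⧸ p))) := by
  refine (injective_iff_map_eq_zero _).mpr fun x hx => ?_
  have key {r : R} (hr : r ∉ p) {y : (A ⊗[R] FractionRing (R ⧸ p)) ⊗[A] V} (hy : r • y = 0) :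
      y = 0 := by
    rwa [← algebraMap_smul (A ⊗[R] FractionRing (R ⧸ p)) r y,
      (isUnit_algebraMap_fiber hr).smul_eq_zero] at hy
  obtain ⟨r, hr, v, hv⟩ := exists_smul_eq_one_tmul_fiber x
  have hfv : (1 : A ⊗[R] FractionRing (R ⧸ p)) ⊗ₜ[A] f v = 0 := by
    rw [← LinearMap.lTensor_tmul, ← hv, ← algebraMap_smul A r x, map_smul, hx, smul_zero]
  obtain ⟨s, hs, hsv⟩ := exists_smul_eq_zero_of_one_tmul_fiber_eq_zero hW _ hfv
  have hsv' : s • v = 0 := hf <| by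
    rw [← algebraMap_smul A s v, map_smul, algebraMap_smul, hsv, map_zero]
  refine key hr (key hs ?_)
  rw [hv, ← TensorProduct.tmul_smul, hsv', TensorProduct.tmul_zero]

lemma exists_smul_eq_zero_of_rTensor_eq_zero {M : Type u} [AddCommGroup M] [Module A M]
    [Module.Flat (A ⊗[R] FractionRing (R ⧸ p)) ((A ⊗[R] FractionRing (R ⧸ p)) ⊗[A] M)]
    (hV : ∀ r ∈ p, ∀ v : V, r • v = 0) (hW : ∀ r ∈ p, ∀ w : W, r • w = 0)
    {f : V →ₗ[A] W} (hf : Function.Injective f) (x : V ⊗[A] M) (hx : f.rTensor M x = 0) :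
    ∃ r ∉ p, r • x = 0 := by
  refine exists_smul_eq_zero_of_one_tmul_fiber_eq_zero (A := A) (fun r hr y => ?_) x ?_
  · induction y with
    | zero => exact smul_zero r
    | add y z hy hz => rw [smul_add, hy, hz, add_zero]
    | tmul v m => rw [TensorProduct.smul_tmul', hV r hr, TensorProduct.zero_tmul]
  · apply lTensor_rTensor_injective_of_flat_baseChange f (lTensor_fiber_injective hW hf)
    rw [LinearMap.lTensor_tmul, hx, TensorProduct.tmul_zero, map_zero]

end

section
variable {R A M F : Type} [CommRing R] [CommRing A] [Algebra R A] [AddCommGroup M] [Module A M]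
  [AddCommGroup F] [Module A F] {π : F →ₗ[A] M} {p : Ideal R}

namespace IsTransverse

variable (π) in
/-- All `A`-modules annihilated by the ideal `I` of `R` are transverse to `π`. -/
def AllKilledBy (I : Ideal R) : Prop :=
  ∀ (X : Type) [AddCommGroup X] [Module R X] [Module A X] [IsScalarTower R A X],
    (∀ r ∈ I, ∀ x : X, r • x = 0) → IsTransverse π X

variable {X : Type} [AddCommGroup X] [Module R X] [Module A X] [IsScalarTower R A X]

lemma smul_quotient_eq_zero {r : R} (hr : ∀ x : X, r • x = 0) (N : Submodule A X) (y : X ⧸ N) :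
    r • y = 0 := by
  obtain ⟨x, rfl⟩ := N.mkQ_surjective y
  exact (congrArg N.mkQ (hr x)).trans (map_zero _)

lemma of_smul_eq_zero (ih : ∀ J > p, AllKilledBy π J) (hX : ∀ r ∈ p, ∀ x : X, r • x = 0)
    {s : R} (hs : s ∉ p) (hsX : ∀ x : X, s • x = 0) : IsTransverse π X := by
  refine ih (p ⊔ Ideal.span {s}) (left_lt_sup.mpr ?_) X fun r hr x => ?_
  · rwa [Ideal.span_singleton_le_iff_mem]
  · obtain ⟨a, ha, b, hb, rfl⟩ := Submodule.mem_sup.mp hr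
    obtain ⟨c, rfl⟩ := Ideal.mem_span_singleton'.mp hb
    rw [add_smul, hX a ha, mul_smul, hsX, smul_zero, add_zero]

lemma of_torsion [Module.Flat A F] [hp : p.IsPrime] (ih : ∀ J > p, AllKilledBy π J)
    (hX : ∀ r ∈ p, ∀ x : X, r • x = 0) (htors : ∀ x : X, ∃ r ∉ p, r • x = 0) :
    IsTransverse π X := by
  refine of_fg fun N hN => ?_
  obtain ⟨t, rfl⟩ := hN
  choose r hr hrx using htors
  refine of_smul_eq_zero ih (s := ∏ x ∈ t, r x) (fun a ha x => Subtype.ext (hX a ha x)) ?_ ?_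
  · rw [hp.prod_mem_iff]
    rintro ⟨x, -, hx⟩
    exact hr x hx
  · rintro ⟨x, hx⟩
    refine Subtype.ext (?_ : (∏ x ∈ t, r x) • x = 0)
    induction hx using Submodule.span_induction with
    | mem x hx =>
      obtain ⟨c, hc⟩ := Finset.dvd_prod_of_mem r hx
      rw [hc, mul_comm, mul_smul, hrx, smul_zero]
    | zero => exact smul_zero _
    | add x y _ _ hx hy => rw [smul_add, hx, hy, add_zero]
    | smul a x _ hx => rw [smul_comm, hx, smul_zero]

lemma smul_tensor_injective [Module.Flat A F] (hπ : Function.Surjective π)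
    (ih : ∀ J > p, AllKilledBy π J) (hX : ∀ r ∈ p, ∀ x : X, r • x = 0)
    (htf : ∀ r ∉ p, ∀ x : X, r • x = 0 → x = 0) {s : R} (hs : s ∉ p) (y : X ⊗[A] M)
    (hy : s • y = 0) : y = 0 := by
  let f : X →ₗ[A] X := LinearMap.lsmul A X (algebraMap R A s)
  have hf (x : X) : f x = s • x := algebraMap_smul A s x
  have hinj : Function.Injective (f.rTensor M) := by
    refine rTensor_injective hπ ((injective_iff_map_eq_zero _).mpr fun x hx => ?_)
      (LinearMap.exact_map_mkQ_range f) (Submodule.mkQ_surjective _)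
      (of_smul_eq_zero ih (fun r hr => smul_quotient_eq_zero (hX r hr) _) hs fun x => ?_)
    · exact htf s hs x (by rwa [← hf])
    · obtain ⟨x, rfl⟩ := Submodule.mkQ_surjective _ x
      exact (Submodule.Quotient.mk_eq_zero _).mpr ⟨x, hf x⟩
  refine (injective_iff_map_eq_zero _).mp hinj y ?_
  have : f.rTensor M = algebraMap R A s • LinearMap.id := by
    ext x m
    simp [f, TensorProduct.smul_tmul']
  rw [this, LinearMap.smul_apply, LinearMap.id_apply, algebraMap_smul, hy]

/-- The torsion-free quotient of `A ⧸ pA` over `R ⧸ p`. -/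
abbrev TorsionFreeFiber (A : Type) [CommRing A] [Algebra R A] (p : Ideal R) [hp : p.IsPrime] :
    Type :=
  (A ⧸ Ideal.map (algebraMap R A) p) ⧸
    relTorsion R p hp A (algebraMap R A) (A ⧸ Ideal.map (algebraMap R A) p)

lemma smul_torsionFreeFiber [hp : p.IsPrime] (r : R) (hr : r ∈ p) (c : TorsionFreeFiber A p) :
    r • c = 0 := by
  refine smul_quotient_eq_zero (fun b => ?_) _ c
  obtain ⟨a, rfl⟩ := Submodule.mkQ_surjective _ b
  refine (Submodule.Quotient.mk_eq_zero _).mpr (?_ : r • a ∈ _)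
  rw [Algebra.smul_def]
  exact Ideal.mul_mem_right _ _ (Ideal.mem_map_of_mem _ hr)

lemma mem_relTorsion_iff [hp : p.IsPrime] {x : X} :
    x ∈ relTorsion R p hp A (algebraMap R A) X ↔ ∃ r ∉ p, r • x = 0 := by
  change (∃ r : R, r ∉ p ∧ algebraMap R A r • x = 0) ↔ _
  simp only [algebraMap_smul]

lemma torsionFree_quotient [hp : p.IsPrime] {r : R} (hr : r ∉ p)
    (x : X ⧸ relTorsion R p hp A (algebraMap R A) X) (hx : r • x = 0) : x = 0 := by
  obtain ⟨x, rfl⟩ := Submodule.mkQ_surjective _ x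
  obtain ⟨s, hs, hsx⟩ := mem_relTorsion_iff.mp
    ((Submodule.Quotient.mk_eq_zero (relTorsion R p hp A (algebraMap R A) X)).mp hx)
  refine (Submodule.Quotient.mk_eq_zero _).mpr (mem_relTorsion_iff.mpr
    ⟨s * r, fun h => (hp.mem_or_mem h).elim hs hr, ?_⟩)
  rw [mul_smul, hsx]

lemma exists_torsionFreeFiber_hom [hp : p.IsPrime] (hX : ∀ r ∈ p, ∀ x : X, r • x = 0)
    (htf : ∀ r ∉ p, ∀ x : X, r • x = 0 → x = 0) (x : X) :
    ∃ (g : TorsionFreeFiber A p →ₗ[A] X) (c : TorsionFreeFiber A p), g c = x := by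
  have h₁ : Ideal.map (algebraMap R A) p ≤ LinearMap.ker (LinearMap.toSpanSingleton A X x) := by
    refine Ideal.map_le_iff_le_comap.mpr fun r hr => ?_
    change algebraMap R A r • x = 0
    rw [algebraMap_smul, hX r hr]
  let g₁ := Submodule.liftQ _ _ h₁
  have h₂ : relTorsion R p hp A (algebraMap R A) _ ≤ LinearMap.ker g₁ := by
    rintro c ⟨r, hr, hrc⟩
    refine htf r hr _ ?_
    rw [← algebraMap_smul A r, ← map_smul, hrc, map_zero]
  refine ⟨Submodule.liftQ _ g₁ h₂, Submodule.mkQ _ (Submodule.mkQ _ 1), ?_⟩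
  exact one_smul A x

lemma of_torsionFree_generator [Module.Flat A F] [hp : p.IsPrime] (hπ : Function.Surjective π)
    [Module.Flat (A ⊗[R] FractionRing (R ⧸ p)) ((A ⊗[R] FractionRing (R ⧸ p)) ⊗[A] M)]
    (ih : ∀ J > p, AllKilledBy π J)
    {C : Type} [AddCommGroup C] [Module R C] [Module A C] [IsScalarTower R A C]
    (hC : IsTransverse π C) (hpC : ∀ r ∈ p, ∀ c : C, r • c = 0)
    (htf : ∀ r ∉ p, ∀ c : C, r • c = 0 → c = 0)
    {X : Type} [AddCommGroup X] [Module A X]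
    (hgen : ∀ x : X, ∃ (g : C →ₗ[A] X) (c : C), g c = x) : IsTransverse π X := by
  choose g c hgc using hgen
  let G : (X →₀ C) →ₗ[A] X := Finsupp.lsum ℕ g
  have hG : Function.Surjective G := fun x => ⟨Finsupp.single x (c x), by simp [G, hgc]⟩
  have hfin (r : R) (hr : r ∈ p) (y : X →₀ C) : r • y = 0 :=
    Finsupp.ext fun x => hpC r hr (y x)
  have hker (r : R) (hr : r ∈ p) (y : LinearMap.ker G) : r • y = 0 := Subtype.ext (hfin r hr y)
  refine of_rTensor_injective hπ (LinearMap.exact_subtype_ker_map G) hG (hC.finsupp X)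
    ((injective_iff_map_eq_zero _).mpr fun y hy => ?_)
  obtain ⟨r, hr, hry⟩ := exists_smul_eq_zero_of_rTensor_eq_zero hker hfin
    (LinearMap.ker G).subtype_injective y hy
  refine smul_tensor_injective hπ ih hker (fun s hs z hz => ?_) hr y hry
  exact Subtype.ext (Finsupp.ext fun x =>
    htf s hs _ (DFunLike.congr_fun (congrArg Subtype.val hz) x))

lemma allKilledBy_prime [Module.Flat A F] [hp : p.IsPrime] (hπ : Function.Surjective π)
    [Module.Flat (A ⊗[R] FractionRing (R ⧸ p)) ((A ⊗[R] FractionRing (R ⧸ p)) ⊗[A] M)]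
    (hC : IsTransverse π (TorsionFreeFiber A p))
    (ih : ∀ J > p, AllKilledBy π J) : AllKilledBy π p := by
  intro X _ _ _ _ hX
  let t := relTorsion R p hp A (algebraMap R A) X
  refine of_exact t.subtype_injective (LinearMap.exact_subtype_mkQ t) t.mkQ_surjective
    (of_torsion ih (fun r hr x => Subtype.ext (hX r hr x)) fun x => ?_)
    (of_torsionFree_generator hπ ih hC smul_torsionFreeFiber (fun r hr => torsionFree_quotient hr)
      (exists_torsionFreeFiber_hom (fun r hr => smul_quotient_eq_zero (hX r hr) t)
        fun r hr => torsionFree_quotient hr))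
  obtain ⟨r, hr, hrx⟩ := mem_relTorsion_iff.mp x.2
  exact ⟨r, hr, Subtype.ext hrx⟩

lemma allKilledBy_of_mul_mem [Module.Flat A F] {I : Ideal R} (ih : ∀ J > I, AllKilledBy π J)
    {a b : R} (ha : a ∉ I) (hb : b ∉ I) (hab : a * b ∈ I) : AllKilledBy π I := by
  intro X _ _ _ _ hX
  let t := LinearMap.range (LinearMap.lsmul A X (algebraMap R A a))
  refine of_exact t.subtype_injective (LinearMap.exact_subtype_mkQ t) t.mkQ_surjective
    (of_smul_eq_zero ih (fun r hr x => Subtype.ext (hX r hr x)) hb ?_)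
    (of_smul_eq_zero ih (fun r hr => smul_quotient_eq_zero (hX r hr) t) ha fun x => ?_)
  · rintro ⟨_, x, rfl⟩
    refine Subtype.ext (?_ : b • algebraMap R A a • x = 0)
    rw [algebraMap_smul, ← mul_smul, mul_comm, hX _ hab]
  · obtain ⟨x, rfl⟩ := Submodule.mkQ_surjective _ x
    exact (Submodule.Quotient.mk_eq_zero _).mpr ⟨x, algebraMap_smul A a x⟩

lemma allKilledBy [IsNoetherianRing R] [Module.Flat A F] (hπ : Function.Surjective π)
    (hfib : ∀ (p : Ideal R) [p.IsPrime],
      Module.Flat (A ⊗[R] FractionRing (R ⧸ p)) ((A ⊗[R] FractionRing (R ⧸ p)) ⊗[A] M))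
    (hC : ∀ (p : Ideal R) [p.IsPrime], IsTransverse π (TorsionFreeFiber A p))
    (I : Ideal R) : AllKilledBy π I := by
  induction I using WellFoundedGT.induction with
  | ind I ih =>
    by_cases hI : I.IsPrime
    · have := hfib I
      exact allKilledBy_prime hπ (hC I) ih
    rw [Ideal.not_isPrime_iff] at hI
    obtain rfl | ⟨a, ha, b, hb, hab⟩ := hI
    · intro X _ _ _ _ hX
      have : Subsingleton X := subsingleton_of_forall_eq 0 fun x => by
        rw [← one_smul R x, hX 1 trivial]
      exact Function.injective_of_subsingleton _
    · exact allKilledBy_of_mul_mem ih ha hb hab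

end IsTransverse

end

theorem flat_iff_fiber_criterion
    (R A M : Type) [CommRing R] [IsNoetherianRing R] [CommRing A] [Algebra R A]
    [AddCommGroup M] [Module A M] :
    Module.Flat A M ↔
      ∀ (p : Ideal R) [hp : p.IsPrime],
        (Subsingleton (((Tor (ModuleCat A) 1).obj
            (ModuleCat.of A (A ⧸ Ideal.map (algebraMap R A) p))).obj (ModuleCat.of A M)) ∧
         Subsingleton (((Tor (ModuleCat A) 1).obj
            (ModuleCat.of A ((A ⧸ Ideal.map (algebraMap R A) p) ⧸
              relTorsion R p hp A (algebraMap R A)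
                (A ⧸ Ideal.map (algebraMap R A) p)))).obj (ModuleCat.of A M))) ∧
        Module.Flat (A ⊗[R] FractionRing (R ⧸ p)) ((A ⊗[R] FractionRing (R ⧸ p)) ⊗[A] M) := by
  obtain ⟨F, _, _, π, _, hπ, hTor⟩ := exists_flat_surjection_tor_iff A M
  constructor
  · intro _ p hp
    have h (X : Type) [AddCommGroup X] [Module A X] :
        Function.Injective ((LinearMap.ker π).subtype.lTensor X) :=
      LinearMap.lTensor_injective_of_exact_of_flat π hπ _ (LinearMap.ker π).subtype_injective
        (LinearMap.exact_subtype_ker_map π) X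
    exact ⟨⟨(hTor _).mpr (h _), (hTor _).mpr (h _)⟩, inferInstance⟩
  · intro h
    have hbot : IsTransverse.AllKilledBy π (⊥ : Ideal R) :=
      IsTransverse.allKilledBy hπ (fun p _ => (h p).2) (fun p _ => (hTor _).mp (h p).1.2) ⊥
    refine Module.Flat.iff_rTensor_injective'.mpr fun I => ?_
    refine IsTransverse.rTensor_injective hπ I.subtype_injective (LinearMap.exact_subtype_mkQ I)
      I.mkQ_surjective (hbot _ fun r hr x => ?_)
    rw [(Submodule.mem_bot R).mp hr, zero_smul]
end
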